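/- Assume additionally that yⁿ = I, and that either γ = 0 or x is diagonalizable and invertible. Let H = x + γ y and let λ ≠ 0 be an eigenvalue of x. Then for every μ ∈ ℂ with μⁿ = λⁿ + γⁿ one has the equality of geometric multiplicities μ_g(μ, H) = μ_g(λ, x). -/

import Mathlib

open Matrix

/-- The geometric multiplicity of `μ` as an eigenvalue of `A`:
the dimension of `ker (μ • 1 − A)`. -/
noncomputable def geomMult {N : ℕ} (A : Matrix (Fin N) (Fin N) ℂ) (μ : ℂ) : ℕ :=
  Module.finrank ℂ (LinearMap.ker (μ • (1 : Matrix (Fin N) (Fin N) ℂ) - A).mulVecLin)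

/-- A matrix is diagonalizable if it is similar to a diagonal matrix. -/
def Diagonalizable {N : ℕ} (A : Matrix (Fin N) (Fin N) ℂ) : Prop :=
  ∃ P : Matrix (Fin N) (Fin N) ℂ, IsUnit P ∧ (P⁻¹ * A * P).IsDiag

lemma aux_mem {N : ℕ} (A : Matrix (Fin N) (Fin N) ℂ) (a : ℂ) (v : Fin N → ℂ) :
    v ∈ LinearMap.ker (a • (1 : Matrix (Fin N) (Fin N) ℂ) - A).mulVecLin ↔ A *ᵥ v = a • v := by
  rw [LinearMap.mem_ker, Matrix.mulVecLin_apply, Matrix.sub_mulVec, Matrix.smul_mulVec,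
    Matrix.one_mulVec, sub_eq_zero, eq_comm]

lemma aux_le {N : ℕ} (A B M : Matrix (Fin N) (Fin N) ℂ) (a b : ℂ)
    (h1 : ∀ v, A *ᵥ v = a • v → B *ᵥ (M *ᵥ v) = b • (M *ᵥ v))
    (h2 : ∀ v, A *ᵥ v = a • v → M *ᵥ v = 0 → v = 0) : geomMult A a ≤ geomMult B b := by
  unfold geomMult
  have h : ∀ v ∈ LinearMap.ker (a • (1 : Matrix (Fin N) (Fin N) ℂ) - A).mulVecLin,
      M.mulVecLin v ∈ LinearMap.ker (b • (1 : Matrix (Fin N) (Fin N) ℂ) - B).mulVecLin := by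
    intro v hv
    rw [aux_mem] at hv ⊢
    exact h1 v hv
  refine LinearMap.finrank_le_finrank_of_injective (f := M.mulVecLin.restrict h) ?_
  rw [← LinearMap.ker_eq_bot, LinearMap.ker_eq_bot']
  rintro ⟨v, hv⟩ hz
  have := congrArg Subtype.val hz
  simp only [LinearMap.coe_restrict_apply, Matrix.mulVecLin_apply] at this
  exact Subtype.ext (h2 v ((aux_mem _ _ _).1 hv) this)

lemma aux_pow {N : ℕ} (x y : Matrix (Fin N) (Fin N) ℂ) (q : ℂ) (hxy : x * y = q • (y * x))
    (a : ℂ) (v : Fin N → ℂ) (hv : x *ᵥ v = a • v) (k : ℕ) :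
    x *ᵥ (y ^ k *ᵥ v) = (q ^ k * a) • (y ^ k *ᵥ v) := by
  induction k with
  | zero => simpa using hv
  | succ k ih =>
    rw [pow_succ', ← Matrix.mulVec_mulVec, Matrix.mulVec_mulVec _ x y, hxy, Matrix.smul_mulVec,
      ← Matrix.mulVec_mulVec, ih, Matrix.mulVec_smul, smul_smul]
    congr 1
    ring

lemma aux_root {n : ℕ} (hn : 0 < n) {q : ℂ} (hq : IsPrimitiveRoot q n) (a b : ℂ) (ha : a ≠ 0)
    (h : b ^ n = a ^ n) : ∃ k : ℕ, b = q ^ k * a := by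
  have : NeZero n := ⟨hn.ne'⟩
  have h1 : (b / a) ^ n = 1 := by rw [div_pow, h, div_self (pow_ne_zero _ ha)]
  obtain ⟨i, _, hi⟩ := hq.eq_pow_of_pow_eq_one h1
  exact ⟨i, by rw [hi]; field_simp⟩

lemma aux_prod {n : ℕ} (hn : 0 < n) {q : ℂ} (hq : IsPrimitiveRoot q n) (a b : ℂ) :
    ∏ j ∈ Finset.range n, (a - q ^ (j + 1) * b) = a ^ n - b ^ n := by
  have : NeZero n := ⟨hn.ne'⟩
  have h := hq.pow_sub_pow_eq_prod_sub_mul a (q * b) hn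
  rw [mul_pow, hq.pow_eq_one, one_mul] at h
  rw [h]
  refine Finset.prod_bij (fun j _ => q ^ j) ?_ ?_ ?_ ?_
  · intro j _
    rw [Polynomial.mem_nthRootsFinset hn, ← pow_mul, mul_comm, pow_mul, hq.pow_eq_one, one_pow]
  · intro i hi j hj hij
    exact hq.pow_inj (Finset.mem_range.1 hi) (Finset.mem_range.1 hj) hij
  · intro z hz
    rw [Polynomial.mem_nthRootsFinset hn] at hz
    obtain ⟨i, hi, h⟩ := hq.eq_pow_of_pow_eq_one hz
    exact ⟨i, Finset.mem_range.2 hi, h⟩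
  · intro j _
    ring

lemma aux_E {N : ℕ} {q : ℂ} (hq : q ≠ 0) (x y : Matrix (Fin N) (Fin N) ℂ)
    (hxy : x * y = q • (y * x)) (hd : Diagonalizable x) :
    ∃ E : ℂ → Matrix (Fin N) (Fin N) ℂ, (∀ ν, x * E ν = ν • E ν) ∧ (∀ ν, E ν * x = ν • E ν) ∧
      (∀ ν, E (q * ν) * y = y * E ν) ∧ (∀ w, (∀ ν, E ν *ᵥ w = 0) → w = 0) ∧
      (∀ ν v, x *ᵥ v = ν • v → E ν *ᵥ v = v) := by
  obtain ⟨P, hP, hD⟩ := hd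
  obtain ⟨d, hd⟩ : ∃ d, P⁻¹ * x * P = diagonal d := ⟨_, hD.diagonal_diag.symm⟩
  have hdet := (Matrix.isUnit_iff_isUnit_det P).1 hP
  have e1 : P⁻¹ * P = 1 := Matrix.nonsing_inv_mul P hdet
  have e2 : P * P⁻¹ = 1 := Matrix.mul_nonsing_inv P hdet
  have c1 : ∀ M, P⁻¹ * (P * M) = M := fun M => by rw [← mul_assoc, e1, one_mul]
  have c2 : ∀ M, P * (P⁻¹ * M) = M := fun M => by rw [← mul_assoc, e2, one_mul]
  obtain ⟨y', hy⟩ : ∃ y', y = P * y' * P⁻¹ := ⟨P⁻¹ * y * P, by simp only [mul_assoc, c2, e2, mul_one]⟩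
  have hx : x = P * diagonal d * P⁻¹ := by rw [← hd]; simp only [mul_assoc, c2, e2, mul_one]
  have hxy' : diagonal d * y' = q • (y' * diagonal d) := by
    have := congrArg (fun M => P⁻¹ * M * P) hxy
    simpa only [hx, hy, mul_assoc, c1, c2, e1, mul_one, Matrix.mul_smul, Matrix.smul_mul] using this
  have hent : ∀ i j, y' i j = 0 ∨ d i = q * d j := by
    intro i j
    have := congrFun (congrFun hxy' i) j
    rw [Matrix.diagonal_mul, Matrix.smul_apply, Matrix.mul_diagonal, smul_eq_mul] at this
    by_cases h : y' i j = 0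
    · exact Or.inl h
    · right
      apply mul_right_cancel₀ h
      rw [this]; ring
  let e : ℂ → Fin N → ℂ := fun ν i => if d i = ν then 1 else 0
  refine ⟨fun ν => P * diagonal (e ν) * P⁻¹, ?_, ?_, ?_, ?_, ?_⟩
  · intro ν
    have : diagonal d * diagonal (e ν) = ν • diagonal (e ν) := by
      rw [Matrix.diagonal_mul_diagonal, ← Matrix.diagonal_smul]
      congr 1; ext i; by_cases h : d i = ν <;> simp [e, h]
    have h2 := congrArg (fun M => P * M * P⁻¹) this
    simpa only [hx, mul_assoc, c1, Matrix.mul_smul, Matrix.smul_mul] using h2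
  · intro ν
    have : diagonal (e ν) * diagonal d = ν • diagonal (e ν) := by
      rw [Matrix.diagonal_mul_diagonal, ← Matrix.diagonal_smul]
      congr 1; ext i; by_cases h : d i = ν <;> simp [e, h]
    have h2 := congrArg (fun M => P * M * P⁻¹) this
    simpa only [hx, mul_assoc, c1, Matrix.mul_smul, Matrix.smul_mul] using h2
  · intro ν
    have : diagonal (e (q * ν)) * y' = y' * diagonal (e ν) := by
      ext i j
      rw [Matrix.diagonal_mul, Matrix.mul_diagonal]
      rcases hent i j with h | h
      · simp [h]
      · simp [e, h, hq]
    have h2 := congrArg (fun M => P * M * P⁻¹) this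
    simpa only [hy, mul_assoc, c1] using h2
  · intro w hw
    have h0 : P⁻¹ *ᵥ w = 0 := by
      ext i
      have := congrArg (fun u => P⁻¹ *ᵥ u) (hw (d i))
      simp only [Matrix.mulVec_mulVec, mul_assoc, c1, Matrix.mulVec_zero] at this
      rw [← Matrix.mulVec_mulVec] at this
      have := congrFun this i
      rw [Matrix.mulVec_diagonal] at this
      simpa [e] using this
    have := congrArg (fun u => P *ᵥ u) h0
    simpa only [Matrix.mulVec_mulVec, e2, Matrix.one_mulVec, Matrix.mulVec_zero] using this
  · intro ν v hv
    have h0 : diagonal (e ν) *ᵥ (P⁻¹ *ᵥ v) = P⁻¹ *ᵥ v := by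
      have := congrArg (fun u => P⁻¹ *ᵥ u) hv
      simp only [hx, Matrix.mulVec_mulVec, mul_assoc, c1, Matrix.mulVec_smul] at this
      rw [← Matrix.mulVec_mulVec] at this
      ext i
      have := congrFun this i
      rw [Matrix.mulVec_diagonal, Pi.smul_apply, smul_eq_mul] at this
      rw [Matrix.mulVec_diagonal]
      by_cases h : d i = ν
      · simp [e, h]
      · have h3 : (d i - ν) * (P⁻¹ *ᵥ v) i = 0 := by rw [sub_mul, this, sub_self]
        rcases mul_eq_zero.1 h3 with h4 | h4
        · exact absurd (sub_eq_zero.1 h4) h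
        · rw [h4, mul_zero]
    have := congrArg (fun u => P *ᵥ u) h0
    simpa only [Matrix.mulVec_mulVec, mul_assoc, e2, Matrix.one_mulVec] using this

lemma aux_zero {N n : ℕ} (hn : 0 < n) {q : ℂ} (hq : IsPrimitiveRoot q n)
    (x y : Matrix (Fin N) (Fin N) ℂ) (hxy : x * y = q • (y * x)) (hyn : y ^ n = 1)
    (a b : ℂ) (ha : a ≠ 0) (h : b ^ n = a ^ n) : geomMult x a ≤ geomMult x b := by
  obtain ⟨k, rfl⟩ := aux_root hn hq a b ha h
  refine aux_le x x (y ^ k) _ _ (fun v hv => aux_pow x y q hxy a v hv k) ?_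
  intro v _ hz
  have hu : IsUnit (y ^ k) := (IsUnit.of_pow_eq_one hyn hn.ne').pow k
  obtain ⟨u, hu⟩ := hu
  have := congrArg (fun w => (↑u⁻¹ : Matrix (Fin N) (Fin N) ℂ) *ᵥ w) hz
  rw [← hu] at this
  simpa only [Matrix.mulVec_mulVec, Units.inv_mul, Matrix.one_mulVec, Matrix.mulVec_zero] using this

theorem stmt7 {N n : ℕ} (hN : 0 < N) (hn : 0 < n) {q : ℂ} (hq : IsPrimitiveRoot q n)
    (x y : Matrix (Fin N) (Fin N) ℂ) (hxy : x * y = q • (y * x)) (hyn : y ^ n = 1)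
    (γ : ℂ) (hcase : γ = 0 ∨ (Diagonalizable x ∧ IsUnit x))
    (lam : ℂ) (hlam0 : lam ≠ 0) (hlam : lam ∈ spectrum ℂ x)
    (μ : ℂ) (hμ : μ ^ n = lam ^ n + γ ^ n) :
    geomMult (x + γ • y) μ = geomMult x lam := by
  by_cases hγ : γ = 0
  · subst hγ
    rw [zero_pow hn.ne', add_zero] at hμ
    rw [zero_smul, add_zero]
    have hμ0 : μ ≠ 0 := by
      rintro rfl
      rw [zero_pow hn.ne'] at hμ
      exact pow_ne_zero n hlam0 hμ.symm
    exact le_antisymm (aux_zero hn hq x y hxy hyn _ _ hμ0 hμ.symm)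
      (aux_zero hn hq x y hxy hyn _ _ hlam0 hμ)
  have hdiag := (hcase.resolve_left hγ).1
  obtain ⟨E, E1, E2, E3, E4, E5⟩ := aux_E (hq.ne_zero hn.ne') x y hxy hdiag
  have hqk : ∀ k : ℕ, (q ^ k) ^ n = 1 := fun k => by
    rw [← pow_mul, mul_comm, pow_mul, hq.pow_eq_one, one_pow]
  have hfac : ∀ k : ℕ, μ - q ^ k * lam ≠ 0 := by
    intro k hk
    rw [sub_eq_zero.1 hk, mul_pow, hqk, one_mul] at hμ
    exact pow_ne_zero n hγ (left_eq_add.1 hμ)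
  have hpne : ∀ k : ℕ, ∏ j ∈ Finset.range k, (μ - q ^ (j + 1) * lam) ≠ 0 := fun k =>
    Finset.prod_ne_zero_iff.2 fun j _ => hfac _
  apply le_antisymm
  · refine aux_le _ _ (E lam) _ _ ?_ ?_
    · intro w _
      rw [Matrix.mulVec_mulVec, E1, Matrix.smul_mulVec]
    · intro w hw hz
      have step : ∀ ν, (μ - q * ν) • (E (q * ν) *ᵥ w) = γ • (y *ᵥ (E ν *ᵥ w)) := by
        intro ν
        have h := congrArg (fun u => E (q * ν) *ᵥ u) hw
        simp only [Matrix.mulVec_smul, Matrix.mulVec_add, Matrix.add_mulVec,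
          Matrix.smul_mulVec] at h
        rw [Matrix.mulVec_mulVec, Matrix.mulVec_mulVec, E2, E3, Matrix.smul_mulVec] at h
        rw [sub_smul, ← h, Matrix.mulVec_mulVec, add_sub_cancel_left]
      have iter : ∀ ν (k : ℕ), (∏ j ∈ Finset.range k, (μ - q ^ (j + 1) * ν)) •
          (E (q ^ k * ν) *ᵥ w) = γ ^ k • (y ^ k *ᵥ (E ν *ᵥ w)) := by
        intro ν k
        induction k with
        | zero => simp
        | succ k ih =>
          have hs := step (q ^ k * ν)
          rw [← mul_assoc, ← pow_succ'] at hs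
          rw [Finset.prod_range_succ, mul_smul, hs, smul_comm, ← Matrix.mulVec_smul, ih,
            Matrix.mulVec_smul, smul_smul, ← pow_succ', Matrix.mulVec_mulVec, ← pow_succ']
      apply E4
      intro ν
      have h := iter ν n
      rw [aux_prod hn hq, hq.pow_eq_one, one_mul, hyn, Matrix.one_mulVec, ← sub_eq_zero,
        ← sub_smul, smul_eq_zero] at h
      rcases h with h | h
      · have h' : ν ^ n = lam ^ n := by linear_combination hμ - h
        obtain ⟨k, rfl⟩ := aux_root hn hq lam ν hlam0 h'
        have h2 := iter lam k
        rw [hz, Matrix.mulVec_zero, smul_zero, smul_eq_zero] at h2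
        exact h2.resolve_left (hpne k)
      · exact h
  · let c : ℕ → ℂ := fun k => γ ^ k / ∏ j ∈ Finset.range k, (μ - q ^ (j + 1) * lam)
    have hc : ∀ k, c (k + 1) * (μ - q ^ (k + 1) * lam) = γ * c k := by
      intro k
      simp only [c]
      rw [Finset.prod_range_succ]
      have h1 := hpne k
      have h2 := hfac (k + 1)
      revert h1 h2
      generalize ∏ j ∈ Finset.range k, (μ - q ^ (j + 1) * lam) = A
      generalize μ - q ^ (k + 1) * lam = B
      intro h1 h2
      field_simp
      ring
    have hc0 : c 0 = 1 := by simp [c]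
    have hcn : c n = 1 := by
      simp only [c]
      rw [aux_prod hn hq, hμ, add_sub_cancel_left, div_self (pow_ne_zero _ hγ)]
    have hM : ∀ v, (∑ k ∈ Finset.range n, c k • y ^ k) *ᵥ v =
        ∑ k ∈ Finset.range n, c k • (y ^ k *ᵥ v) := by
      intro v
      rw [Matrix.sum_mulVec]
      simp only [Matrix.smul_mulVec]
    refine aux_le _ _ (∑ k ∈ Finset.range n, c k • y ^ k) _ _ ?_ ?_
    · intro v hv
      rw [hM]
      let f : ℕ → Fin N → ℂ := fun k => (c k * (μ - q ^ k * lam)) • (y ^ k *ᵥ v)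
      have hf : f n = f 0 := by
        simp only [f, hc0, hcn, hyn, hq.pow_eq_one, pow_zero]
      have hs : ∑ k ∈ Finset.range n, f (k + 1) = ∑ k ∈ Finset.range n, f k := by
        have h1 := Finset.sum_range_succ f n
        have h2 := Finset.sum_range_succ' f n
        rw [h1, hf] at h2
        exact (add_right_cancel h2).symm
      have hA : x *ᵥ (∑ k ∈ Finset.range n, c k • (y ^ k *ᵥ v)) =
          μ • (∑ k ∈ Finset.range n, c k • (y ^ k *ᵥ v)) - ∑ k ∈ Finset.range n, f k := by
        rw [Matrix.mulVec_sum, Finset.smul_sum, ← Finset.sum_sub_distrib]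
        refine Finset.sum_congr rfl fun k _ => ?_
        rw [Matrix.mulVec_smul, aux_pow x y q hxy lam v hv k]
        simp only [f]
        module
      have hB : (γ • y) *ᵥ (∑ k ∈ Finset.range n, c k • (y ^ k *ᵥ v)) =
          ∑ k ∈ Finset.range n, f (k + 1) := by
        rw [Matrix.mulVec_sum]
        refine Finset.sum_congr rfl fun k _ => ?_
        simp only [f]
        rw [hc, Matrix.mulVec_smul, Matrix.smul_mulVec, Matrix.mulVec_mulVec, ← pow_succ',
          smul_smul, mul_comm]
      rw [Matrix.add_mulVec, hA, hB, hs, sub_add_cancel]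
    · intro v hv hz
      rw [hM] at hz
      have h := congrArg (fun u => E lam *ᵥ u) hz
      simp only [Matrix.mulVec_sum, Matrix.mulVec_zero] at h
      rw [Finset.sum_eq_single 0] at h
      · simpa [hc0, E5 lam v hv] using h
      · intro k hk hk0
        have h1 := congrArg (fun u => E lam *ᵥ u) (aux_pow x y q hxy lam v hv k)
        rw [Matrix.mulVec_mulVec, E2, Matrix.smul_mulVec, Matrix.mulVec_smul, ← sub_eq_zero,
          ← sub_smul, smul_eq_zero] at h1
        rcases h1 with h1 | h1
        · exfalso
          have h2 : q ^ k = 1 := by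
            apply mul_right_cancel₀ hlam0
            linear_combination -h1
          exact hq.pow_ne_one_of_pos_of_lt hk0 (Finset.mem_range.1 hk) h2
        · rw [Matrix.mulVec_smul, h1, smul_zero]
      · intro h0
        exact absurd (Finset.mem_range.2 hn) h0
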